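/- arXiv:1710.11483 — 6 statements merged into one kernel-verified Lean document; each statement's English description precedes it below -/
import Mathlib

section
/- Let d ≥ 1 and define Λ(ξ) := √|ξ| for ξ ∈ ℝ^d (the linear dispersion relation of gravity water waves). For any choice of signs ε₁, ε₂ ∈ {+1, −1} and any ξ, η ∈ ℝ^d, if Λ(ξ) + ε₁·Λ(η) + ε₂·Λ(ξ−η) = 0, then ξ = 0 or η = 0 or η = ξ. In other words, the quadratic phases of the gravity water waves system have no time resonances away from the degenerate frequencies. -/
/-- If `√z = √x + √y` while `z ≤ x + y`, then one of the summands vanishes. -/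
theorem Real.eq_zero_or_eq_zero_of_sqrt_eq_add {x y z : ℝ} (hx : 0 ≤ x) (hy : 0 ≤ y)
    (hz : 0 ≤ z) (hle : z ≤ x + y) (h : √z = √x + √y) : x = 0 ∨ y = 0 := by
  have hmul : √x * √y = 0 := by
    nlinarith [Real.sq_sqrt hx, Real.sq_sqrt hy, Real.sq_sqrt hz,
      mul_nonneg (Real.sqrt_nonneg x) (Real.sqrt_nonneg y), congrArg (· ^ 2) h]
  simpa [Real.sqrt_eq_zero hx, Real.sqrt_eq_zero hy] using hmul

/-- **Absence of quadratic time resonances for gravity water waves.**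
With `Λ ξ = √‖ξ‖` on `ℝ^d`, any vanishing of the quadratic phase
`Λ(ξ) + ε₁ Λ(η) + ε₂ Λ(ξ-η)` forces `ξ = 0`, `η = 0`, or `η = ξ`. -/
theorem gravity_no_time_resonances (d : ℕ) (hd : 1 ≤ d) (ε₁ ε₂ : ℝ)
    (hε₁ : ε₁ = 1 ∨ ε₁ = -1) (hε₂ : ε₂ = 1 ∨ ε₂ = -1)
    (ξ η : EuclideanSpace ℝ (Fin d))
    (h : Real.sqrt ‖ξ‖ + ε₁ * Real.sqrt ‖η‖ + ε₂ * Real.sqrt ‖ξ - η‖ = 0) :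
    ξ = 0 ∨ η = 0 ∨ η = ξ := by
  have hξ := norm_nonneg ξ
  have hη := norm_nonneg η
  have hξη := norm_nonneg (ξ - η)
  rcases hε₁ with rfl | rfl <;> rcases hε₂ with rfl | rfl
  · left
    have h0 : √‖ξ‖ = 0 := by
      linarith [Real.sqrt_nonneg ‖ξ‖, Real.sqrt_nonneg ‖η‖, Real.sqrt_nonneg ‖ξ - η‖]
    simpa [Real.sqrt_eq_zero hξ] using h0
  · rcases Real.eq_zero_or_eq_zero_of_sqrt_eq_add hξ hη hξη (norm_sub_le ξ η) (by linarith)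
      with h0 | h0
    · exact Or.inl (norm_eq_zero.mp h0)
    · exact Or.inr (Or.inl (norm_eq_zero.mp h0))
  · have hle : ‖η‖ ≤ ‖ξ‖ + ‖ξ - η‖ := norm_le_norm_add_norm_sub ξ η
    rcases Real.eq_zero_or_eq_zero_of_sqrt_eq_add hξ hξη hη hle (by linarith) with h0 | h0
    · exact Or.inl (norm_eq_zero.mp h0)
    · exact Or.inr (Or.inr (sub_eq_zero.mp (norm_eq_zero.mp h0)).symm)
  · have hle : ‖ξ‖ ≤ ‖η‖ + ‖ξ - η‖ := norm_le_norm_add_norm_sub' ξ η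
    rcases Real.eq_zero_or_eq_zero_of_sqrt_eq_add hη hξη hξ hle (by linarith) with h0 | h0
    · exact Or.inr (Or.inl (norm_eq_zero.mp h0))
    · exact Or.inr (Or.inr (sub_eq_zero.mp (norm_eq_zero.mp h0)).symm)
end

section
/- (Slow propagation of iterated resonances for 3D gravity waves.) Define Λ(ξ) := √|ξ| for ξ ∈ ℝ² and the cubic phase Φ̃(ξ,η,σ) := Λ(ξ) − Λ(ξ−η) + Λ(η−σ) − Λ(σ). Let ξ, η, σ ∈ ℝ² satisfy ξ ≠ 0, ξ−η ≠ 0, η−σ ≠ 0, σ ≠ 0, and the smallness conditions |η| ≤ |ξ|/2 and |ξ−σ| ≤ |ξ|/2. If the gradient of Φ̃ with respect to the variables (η,σ) vanishes at (ξ,η,σ) (i.e. ∇_η Φ̃(ξ,η,σ) = 0 and ∇_σ Φ̃(ξ,η,σ) = 0), then the gradient with respect to ξ also vanishes: ∇_ξ Φ̃(ξ,η,σ) = 0. -/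
open scoped Topology

/-- The gravity water waves dispersion relation `Λ(ξ) = √|ξ|` on `ℝ²`. -/
noncomputable def gravityDisp (ξ : EuclideanSpace ℝ (Fin 2)) : ℝ := Real.sqrt ‖ξ‖

/-- The cubic phase `Φ̃(ξ,η,σ) = Λ(ξ) - Λ(ξ-η) + Λ(η-σ) - Λ(σ)`. -/
noncomputable def cubicPhase3D (ξ η σ : EuclideanSpace ℝ (Fin 2)) : ℝ :=
  gravityDisp ξ - gravityDisp (ξ - η) + gravityDisp (η - σ) - gravityDisp σ

lemma hasFDerivAt_gravityDisp {v : EuclideanSpace ℝ (Fin 2)} (hv : v ≠ 0) :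
    HasFDerivAt gravityDisp
      (innerSL ℝ ((2 * (Real.sqrt ‖v‖ * ‖v‖))⁻¹ • v)) v := by
  have hn : 0 < ‖v‖ := norm_pos_iff.mpr hv
  have h := (((hasStrictFDerivAt_norm_sq v).hasFDerivAt).sqrt
    (pow_ne_zero 2 hn.ne')).sqrt (by simpa using hv)
  simp only [Real.sqrt_sq (norm_nonneg _)] at h
  refine h.congr_fderiv ?_
  ext w
  simp only [map_smul, smul_apply, smul_eq_mul, nsmul_eq_mul]
  have hs : Real.sqrt ‖v‖ ≠ 0 := (Real.sqrt_pos.mpr hn).ne'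
  simp
  field_simp

/-- The gradient of the dispersion relation is odd and injective away from the origin. -/
lemma eq_neg_of_gravityDisp_gradient_eq_neg {a b : EuclideanSpace ℝ (Fin 2)}
    (ha : a ≠ 0) (hb : b ≠ 0)
    (h : (2 * (Real.sqrt ‖a‖ * ‖a‖))⁻¹ • a = -((2 * (Real.sqrt ‖b‖ * ‖b‖))⁻¹ • b)) :
    a = -b := by
  have norm_grad : ∀ {v : EuclideanSpace ℝ (Fin 2)}, v ≠ 0 →
      ‖(2 * (Real.sqrt ‖v‖ * ‖v‖))⁻¹ • v‖ = (2 * Real.sqrt ‖v‖)⁻¹ := by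
    intro v hv
    have hn : 0 < ‖v‖ := norm_pos_iff.mpr hv
    have hs : 0 < Real.sqrt ‖v‖ := Real.sqrt_pos.mpr hn
    rw [norm_smul, Real.norm_of_nonneg (by positivity)]
    field_simp
  have hnorm := congrArg norm h
  rw [norm_neg, norm_grad ha, norm_grad hb, inv_inj, mul_right_inj' two_ne_zero,
    Real.sqrt_inj (norm_nonneg _) (norm_nonneg _)] at hnorm
  have hn : 0 < ‖b‖ := norm_pos_iff.mpr hb
  rw [hnorm, ← smul_neg] at h
  exact smul_right_injective _ (by positivity) h

/-- **Slow propagation of iterated resonances for 3D gravity water waves.**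
If `|η| ≤ |ξ|/2`, `|ξ-σ| ≤ |ξ|/2`, and the gradient of the cubic phase with respect
to `(η,σ)` vanishes, then the gradient with respect to `ξ` vanishes as well. -/
theorem slow_propagation_iterated_resonances
    (ξ η σ : EuclideanSpace ℝ (Fin 2))
    (hξ : ξ ≠ 0) (hξη : ξ - η ≠ 0) (hησ : η - σ ≠ 0) (hσ : σ ≠ 0)
    (hη_small : ‖η‖ ≤ ‖ξ‖ / 2) (hξσ_small : ‖ξ - σ‖ ≤ ‖ξ‖ / 2)
    (hgradη : fderiv ℝ (fun η' => cubicPhase3D ξ η' σ) η = 0)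
    (hgradσ : fderiv ℝ (fun σ' => cubicPhase3D ξ η σ') σ = 0) :
    fderiv ℝ (fun ξ' => cubicPhase3D ξ' η σ) ξ = 0 := by
  have hderiv : HasFDerivAt (fun σ' => cubicPhase3D ξ η σ') _ σ :=
    (((hasFDerivAt_gravityDisp hησ).comp σ ((hasFDerivAt_id σ).const_sub η)).const_add
      (gravityDisp ξ - gravityDisp (ξ - η))).sub (hasFDerivAt_gravityDisp hσ)
  rw [hderiv.fderiv] at hgradσ
  have hη : η = 0 := by
    have h : η - σ = -σ := by
      refine eq_neg_of_gravityDisp_gradient_eq_neg hησ hσ ?_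
      refine ext_inner_right ℝ fun w => ?_
      have hw := DFunLike.congr_fun hgradσ w
      simp only [sub_apply, ContinuousLinearMap.comp_apply,
        neg_apply, ContinuousLinearMap.id_apply, innerSL_apply_apply,
        zero_apply, inner_neg_right] at hw
      rw [inner_neg_left]
      linarith
    simpa [sub_eq_add_neg] using h
  simp [hη, cubicPhase3D]
end

section
/- (Cubic space-time resonances for 2D gravity waves.) Define Λ(x) := √|x| for x ∈ ℝ and the cubic phase Φ̃(ξ,η,σ) := Λ(ξ) − Λ(ξ−η) − Λ(η−σ) + Λ(σ). Fix ξ ∈ ℝ, ξ ≠ 0. For every (η,σ) ∈ ℝ² with ξ−η ≠ 0, η−σ ≠ 0 and σ ≠ 0, the two partial derivatives ∂_η Φ̃(ξ,η,σ) and ∂_σ Φ̃(ξ,η,σ) both vanish if and only if η = 0 and σ = −ξ. Moreover, at this stationary point the phase itself vanishes: Φ̃(ξ,0,−ξ) = 0. Thus the cubic space-time resonances correspond exactly to the frequency interactions (ξ−η, η−σ, σ) = (ξ, ξ, −ξ), which are the source of the modified scattering for 2D gravity water waves. -/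
/-- The gravity water waves dispersion relation `Λ(x) = √|x|` on `ℝ`. -/
noncomputable def gravityDisp1D (x : ℝ) : ℝ := Real.sqrt |x|

/-- The cubic phase `Φ̃(ξ,η,σ) = Λ(ξ) - Λ(ξ-η) - Λ(η-σ) + Λ(σ)` for the `u₊u₊u₋`
interaction in 2D gravity water waves. -/
noncomputable def cubicPhase2D (ξ η σ : ℝ) : ℝ :=
  gravityDisp1D ξ - gravityDisp1D (ξ - η) - gravityDisp1D (η - σ) + gravityDisp1D σ

/-- `Λ'(x) = sgn(x) / (2√|x|)` away from the origin. -/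
theorem hasDerivAt_gravityDisp1D {x : ℝ} (hx : x ≠ 0) :
    HasDerivAt gravityDisp1D ((SignType.sign x : ℝ) / (2 * Real.sqrt |x|)) x :=
  (hasDerivAt_abs hx).sqrt (abs_ne_zero.mpr hx)

theorem deriv_gravityDisp1D_neg (x : ℝ) :
    deriv gravityDisp1D (-x) = -deriv gravityDisp1D x := by
  have h := deriv_comp_neg gravityDisp1D x
  have he : (fun y => gravityDisp1D (-y)) = gravityDisp1D := by
    funext y
    simp [gravityDisp1D]
  rw [he] at h
  linarith

theorem deriv_gravityDisp1D_pos {x : ℝ} (hx : 0 < x) : 0 < deriv gravityDisp1D x := by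
  rw [(hasDerivAt_gravityDisp1D hx.ne').deriv, sign_pos hx]
  have := abs_pos.mpr hx.ne'
  simp only [SignType.coe_one]
  positivity

theorem deriv_gravityDisp1D_injOn_pos {x y : ℝ} (hx : 0 < x) (hy : 0 < y)
    (h : deriv gravityDisp1D x = deriv gravityDisp1D y) : x = y := by
  rw [(hasDerivAt_gravityDisp1D hx.ne').deriv, (hasDerivAt_gravityDisp1D hy.ne').deriv,
    sign_pos hx, sign_pos hy, abs_of_pos hx, abs_of_pos hy] at h
  simp only [SignType.coe_one, one_div] at h
  have h2 : Real.sqrt x = Real.sqrt y := by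
    have := inv_injective h
    linarith
  exact (Real.sqrt_inj hx.le hy.le).mp h2

/-- `Λ'` is injective away from the origin. -/
theorem deriv_gravityDisp1D_inj {x y : ℝ} (hx : x ≠ 0) (hy : y ≠ 0)
    (h : deriv gravityDisp1D x = deriv gravityDisp1D y) : x = y := by
  rcases hx.lt_or_gt with hx | hx <;> rcases hy.lt_or_gt with hy | hy
  · refine neg_injective (deriv_gravityDisp1D_injOn_pos (neg_pos.mpr hx) (neg_pos.mpr hy) ?_)
    rw [deriv_gravityDisp1D_neg, deriv_gravityDisp1D_neg, h]
  · have h1 := deriv_gravityDisp1D_pos (neg_pos.mpr hx)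
    have h2 := deriv_gravityDisp1D_pos hy
    rw [deriv_gravityDisp1D_neg] at h1
    linarith
  · have h1 := deriv_gravityDisp1D_pos (neg_pos.mpr hy)
    have h2 := deriv_gravityDisp1D_pos hx
    rw [deriv_gravityDisp1D_neg] at h1
    linarith
  · exact deriv_gravityDisp1D_injOn_pos hx hy h

theorem deriv_cubicPhase2D_left {ξ η σ : ℝ} (h₁ : ξ - η ≠ 0) (h₂ : η - σ ≠ 0) :
    deriv (fun η' => cubicPhase2D ξ η' σ) η =
      deriv gravityDisp1D (ξ - η) - deriv gravityDisp1D (η - σ) := by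
  have d₁ := (hasDerivAt_gravityDisp1D h₁).differentiableAt.hasDerivAt.comp_const_sub ξ η
  have d₂ := (hasDerivAt_gravityDisp1D h₂).differentiableAt.hasDerivAt.comp_sub_const η σ
  have d := ((d₁.const_sub (gravityDisp1D ξ)).sub d₂).add_const (gravityDisp1D σ)
  rw [neg_neg] at d
  exact d.deriv

theorem deriv_cubicPhase2D_right {ξ η σ : ℝ} (h₂ : η - σ ≠ 0) (h₃ : σ ≠ 0) :
    deriv (fun σ' => cubicPhase2D ξ η σ') σ =
      deriv gravityDisp1D (η - σ) + deriv gravityDisp1D σ := by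
  have d₂ := (hasDerivAt_gravityDisp1D h₂).differentiableAt.hasDerivAt.comp_const_sub η σ
  have d₃ := (hasDerivAt_gravityDisp1D h₃).differentiableAt.hasDerivAt
  have d := (d₂.const_sub (gravityDisp1D ξ - gravityDisp1D (ξ - η))).add d₃
  rw [neg_neg] at d
  exact d.deriv

/-- **Cubic space-time resonances for 2D gravity water waves.**
For fixed `ξ ≠ 0`, the stationary points in `(η,σ)` of the cubic phase (away from the
degenerate frequencies) are exactly `η = 0`, `σ = -ξ`, i.e. the interaction
`(ξ-η, η-σ, σ) = (ξ, ξ, -ξ)`; and there the phase vanishes. -/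
theorem cubic_space_time_resonances_2D (ξ : ℝ) (hξ : ξ ≠ 0) :
    (∀ η σ : ℝ, ξ - η ≠ 0 → η - σ ≠ 0 → σ ≠ 0 →
      ((deriv (fun η' => cubicPhase2D ξ η' σ) η = 0 ∧
        deriv (fun σ' => cubicPhase2D ξ η σ') σ = 0) ↔ (η = 0 ∧ σ = -ξ))) ∧
    cubicPhase2D ξ 0 (-ξ) = 0 := by
  refine ⟨fun η σ h₁ h₂ h₃ => ?_, by simp [cubicPhase2D, gravityDisp1D]⟩
  rw [deriv_cubicPhase2D_left h₁ h₂, deriv_cubicPhase2D_right h₂ h₃]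
  constructor
  · rintro ⟨e₁, e₂⟩
    have i₁ := deriv_gravityDisp1D_inj h₁ h₂ (sub_eq_zero.mp e₁)
    have i₂ : η - σ = -σ := deriv_gravityDisp1D_inj h₂ (neg_ne_zero.mpr h₃) (by
      rw [deriv_gravityDisp1D_neg]
      linarith)
    constructor <;> linarith
  · rintro ⟨rfl, rfl⟩
    simp [deriv_gravityDisp1D_neg]
end

section
/- Define Λ(ξ) := √(|ξ| + |ξ|³) for ξ ∈ ℝ² (the gravity-capillary dispersion relation with g = σ = 1). Then Λ is smooth on ℝ² \ {0}, and for every ξ ≠ 0 the Hessian matrix of Λ at ξ is singular (has determinant zero) if and only if |ξ| = γ₀ := (2/√3 − 1)^{1/2}, equivalently if and only if 3|ξ|⁴ + 6|ξ|² − 1 = 0. This degeneracy of the Hessian on the sphere {|ξ| = γ₀} is the reason why linear gravity-capillary waves decay only at the rate t^{−5/6}. -/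
/-- The gravity-capillary dispersion relation `Λ(ξ) = √(|ξ| + |ξ|³)` on `ℝ²`
(with `g = σ = 1`). -/
noncomputable def gcDisp (ξ : EuclideanSpace ℝ (Fin 2)) : ℝ :=
  Real.sqrt (‖ξ‖ + ‖ξ‖ ^ 3)

/-- The degenerate frequency `γ₀ = (2/√3 - 1)^{1/2}`. -/
noncomputable def γ₀ : ℝ := Real.sqrt (2 / Real.sqrt 3 - 1)

/-- The norm of an inner product space is differentiable away from the origin. -/
lemma hasFDerivAt_norm_of_ne_zero {E : Type*} [NormedAddCommGroup E] [InnerProductSpace ℝ E]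
    {x : E} (hx : x ≠ 0) : HasFDerivAt (fun y : E => ‖y‖) (‖x‖⁻¹ • innerSL ℝ x) x := by
  have h := ((hasStrictFDerivAt_norm_sq x).hasFDerivAt).sqrt (by positivity)
  simp only [Real.sqrt_sq (norm_nonneg _)] at h
  convert h using 1
  rw [← Nat.cast_smul_eq_nsmul ℝ, smul_smul]
  congr 1
  have := norm_ne_zero_iff.2 hx
  push_cast
  field_simp

/-- The quotient of the derivative by `r` for the radial profile `f(r) = √(r + r³)`. -/
noncomputable def gcSlope (r : ℝ) : ℝ := (1 + 3 * r ^ 2) / (2 * r * √(r + r ^ 3))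

/-- The second derivative of the radial profile `f(r) = √(r + r³)`. -/
noncomputable def gcCurv (r : ℝ) : ℝ :=
  (3 * r ^ 4 + 6 * r ^ 2 - 1) / (4 * (r + r ^ 3) * √(r + r ^ 3))

lemma gcSlope_pos {r : ℝ} (hr : 0 < r) : 0 < gcSlope r := by
  unfold gcSlope
  positivity

lemma gcCurv_eq_zero_iff {r : ℝ} (hr : 0 < r) :
    gcCurv r = 0 ↔ 3 * r ^ 4 + 6 * r ^ 2 - 1 = 0 := by
  unfold gcCurv
  rw [div_eq_zero_iff, or_iff_left (by positivity)]

lemma hasDerivAt_sqrt_add_cube {r : ℝ} (hr : 0 < r) :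
    HasDerivAt (fun r : ℝ => √(r + r ^ 3)) (r * gcSlope r) r := by
  have h := ((hasDerivAt_id r).add (hasDerivAt_pow 3 r)).sqrt
    (by simp only [Pi.add_apply, id]; positivity)
  refine h.congr_deriv ?_
  simp only [gcSlope, Pi.add_apply, id]
  have : 0 < √(r + r ^ 3) := by positivity
  push_cast
  field_simp

lemma hasDerivAt_gcSlope {r : ℝ} (hr : 0 < r) :
    HasDerivAt gcSlope ((gcCurv r - gcSlope r) / r) r := by
  have hw : 0 < √(r + r ^ 3) := by positivity
  have hsq : √(r + r ^ 3) ^ 2 = r + r ^ 3 := Real.sq_sqrt (by positivity)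
  have h := (((hasDerivAt_pow 2 r).const_mul 3).const_add 1).div
    (((hasDerivAt_id r).const_mul 2).mul (hasDerivAt_sqrt_add_cube hr))
    (by simp only [Pi.mul_apply, id]; positivity)
  refine h.congr_deriv ?_
  simp only [gcSlope, gcCurv, Pi.mul_apply, id]
  rw [← hsq]
  generalize √(r + r ^ 3) = w at *
  rw [Real.sqrt_sq hw.le]
  push_cast
  field_simp
  rw [hsq]
  ring

lemma hasFDerivAt_gcDisp {ξ : EuclideanSpace ℝ (Fin 2)} (hξ : ξ ≠ 0) :
    HasFDerivAt gcDisp (gcSlope ‖ξ‖ • innerSL ℝ ξ) ξ := by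
  have hr := norm_pos_iff.2 hξ
  have h := (hasDerivAt_sqrt_add_cube hr).comp_hasFDerivAt ξ (hasFDerivAt_norm_of_ne_zero hξ)
  refine h.congr_fderiv ?_
  rw [smul_smul]
  congr 1
  field_simp

/-- The Hessian of the dispersion relation, applied to a vector. -/
lemma fderiv_fderiv_gcDisp {ξ : EuclideanSpace ℝ (Fin 2)} (hξ : ξ ≠ 0)
    (v : EuclideanSpace ℝ (Fin 2)) :
    fderiv ℝ (fderiv ℝ gcDisp) ξ v =
      innerSL ℝ (gcSlope ‖ξ‖ • v +
        ((gcCurv ‖ξ‖ - gcSlope ‖ξ‖) / ‖ξ‖ ^ 2 * inner ℝ ξ v) • ξ) := by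
  have hr := norm_pos_iff.2 hξ
  have heq : fderiv ℝ gcDisp =ᶠ[nhds ξ] fun x => gcSlope ‖x‖ • innerSL ℝ x := by
    filter_upwards [isOpen_ne.mem_nhds hξ] with x hx
    exact (hasFDerivAt_gcDisp hx).fderiv
  have h1 := (hasDerivAt_gcSlope hr).comp_hasFDerivAt ξ (hasFDerivAt_norm_of_ne_zero hξ)
  have h2 := h1.smul (innerSL ℝ (E := EuclideanSpace ℝ (Fin 2))).hasFDerivAt
  rw [heq.fderiv_eq]
  refine (congrArg (· v) h2.fderiv).trans ?_
  ext y
  simp only [map_add, map_smul]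
  simp
  field_simp
  change _ * inner ℝ v y * _ + _ * _ * inner ℝ ξ y = _
  ring

lemma exists_fderiv_fderiv_gcDisp_eq_zero_iff {ξ : EuclideanSpace ℝ (Fin 2)} (hξ : ξ ≠ 0) :
    (∃ v : EuclideanSpace ℝ (Fin 2), v ≠ 0 ∧ fderiv ℝ (fderiv ℝ gcDisp) ξ v = 0) ↔
      gcCurv ‖ξ‖ = 0 := by
  have hr := norm_pos_iff.2 hξ
  have hg := gcSlope_pos hr
  constructor
  · rintro ⟨v, hv, h⟩
    rw [fderiv_fderiv_gcDisp hξ] at h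
    have h0 : gcSlope ‖ξ‖ • v +
        ((gcCurv ‖ξ‖ - gcSlope ‖ξ‖) / ‖ξ‖ ^ 2 * inner ℝ ξ v) • ξ = 0 := by
      rw [← norm_eq_zero, ← innerSL_apply_norm ℝ, h, norm_zero]
    have hin := congrArg (fun w => inner ℝ ξ w) h0
    rw [inner_add_right, inner_smul_right, inner_smul_right, real_inner_self_eq_norm_sq,
      inner_zero_right] at hin
    have hmul : gcCurv ‖ξ‖ * inner ℝ ξ v = 0 := by
      field_simp at hin
      linarith
    refine (mul_eq_zero.1 hmul).resolve_right fun hz => hv ?_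
    rw [hz, mul_zero, zero_smul, add_zero] at h0
    exact (smul_eq_zero.1 h0).resolve_left hg.ne'
  · intro h
    refine ⟨ξ, hξ, ?_⟩
    rw [fderiv_fderiv_gcDisp hξ, h, real_inner_self_eq_norm_sq, ← add_smul]
    have : gcSlope ‖ξ‖ + (0 - gcSlope ‖ξ‖) / ‖ξ‖ ^ 2 * ‖ξ‖ ^ 2 = 0 := by
      field_simp
      ring
    rw [this, zero_smul, map_zero]

lemma eq_γ₀_iff {r : ℝ} (hr : 0 < r) : r = γ₀ ↔ 3 * r ^ 4 + 6 * r ^ 2 - 1 = 0 := by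
  have hs : √3 ^ 2 = (3 : ℝ) := Real.sq_sqrt (by norm_num)
  have hs0 : 0 < √(3 : ℝ) := by positivity
  have hγ : r = γ₀ ↔ r ^ 2 = 2 / √3 - 1 := by
    rw [γ₀, eq_comm, Real.sqrt_eq_iff_mul_self_eq_of_pos hr, pow_two]
  rw [hγ, eq_sub_iff_add_eq, eq_div_iff hs0.ne']
  have hp : 0 < (r ^ 2 + 1) * √3 + 2 := by positivity
  have hfac : ((r ^ 2 + 1) * √3 - 2) * ((r ^ 2 + 1) * √3 + 2) = 3 * r ^ 4 + 6 * r ^ 2 - 1 := by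
    linear_combination (r ^ 2 + 1) ^ 2 * hs
  rw [← hfac, mul_eq_zero, or_iff_left hp.ne', sub_eq_zero]

lemma contDiffOn_gcDisp :
    ContDiffOn ℝ (⊤ : ℕ∞) gcDisp {(0 : EuclideanSpace ℝ (Fin 2))}ᶜ := by
  intro ξ hξ
  have hr : 0 < ‖ξ‖ := norm_pos_iff.2 hξ
  have hn : ContDiffAt ℝ (⊤ : ℕ∞) (fun x : EuclideanSpace ℝ (Fin 2) => ‖x‖) ξ :=
    contDiffAt_norm ℝ hξ
  exact ((hn.add (hn.pow 3)).sqrt (by positivity)).contDiffWithinAt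

/-- **Degeneracy of the Hessian of the gravity-capillary dispersion relation.**
`Λ` is smooth away from the origin, and for `ξ ≠ 0` the Hessian of `Λ` at `ξ` is
singular (has a nontrivial kernel, i.e. determinant zero) iff `‖ξ‖ = γ₀`,
equivalently iff `3‖ξ‖⁴ + 6‖ξ‖² - 1 = 0`. -/
theorem gc_hessian_degenerate :
    ContDiffOn ℝ (⊤ : ℕ∞) gcDisp {(0 : EuclideanSpace ℝ (Fin 2))}ᶜ ∧
    ∀ ξ : EuclideanSpace ℝ (Fin 2), ξ ≠ 0 →
      (((∃ v : EuclideanSpace ℝ (Fin 2), v ≠ 0 ∧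
          fderiv ℝ (fderiv ℝ gcDisp) ξ v = 0) ↔ ‖ξ‖ = γ₀) ∧
        (‖ξ‖ = γ₀ ↔ 3 * ‖ξ‖ ^ 4 + 6 * ‖ξ‖ ^ 2 - 1 = 0)) := by
  refine ⟨contDiffOn_gcDisp, fun ξ hξ => ?_⟩
  have hr := norm_pos_iff.2 hξ
  refine ⟨?_, eq_γ₀_iff hr⟩
  rw [exists_fderiv_fderiv_gcDisp_eq_zero_iff hξ, gcCurv_eq_zero_iff hr, eq_γ₀_iff hr]
end

section
/- Define Λ(ξ) := √(|ξ| + |ξ|³) for ξ ∈ ℝ² and the quadratic phase Φ(ξ,η) := Λ(ξ) − Λ(η) − Λ(ξ−η). For every ξ ∈ ℝ² with ξ ≠ 0, the gradient of the map η ↦ Φ(ξ,η) vanishes at η = ξ/2, and Φ(ξ, ξ/2) = 0 if and only if |ξ| = γ₁ := √2. In particular, every ξ on the sphere {|ξ| = √2} together with η = ξ/2 is a space-time resonance of the gravity-capillary system, i.e. it satisfies Φ(ξ,η) = 0 and ∇_η Φ(ξ,η) = 0. -/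
/-- The quadratic phase `Φ(ξ,η) = Λ(ξ) - Λ(η) - Λ(ξ-η)`. -/
noncomputable def gcPhase (ξ η : EuclideanSpace ℝ (Fin 2)) : ℝ :=
  gcDisp ξ - gcDisp η - gcDisp (ξ - η)

theorem differentiableAt_gcDisp {ξ : EuclideanSpace ℝ (Fin 2)} (hξ : ξ ≠ 0) :
    DifferentiableAt ℝ gcDisp ξ := by
  have hn : DifferentiableAt ℝ (fun η : EuclideanSpace ℝ (Fin 2) => ‖η‖) ξ :=
    differentiableAt_id.norm ℝ hξ
  have hpos : 0 < ‖ξ‖ := norm_pos_iff.mpr hξ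
  have hne : ‖ξ‖ + ‖ξ‖ ^ 3 ≠ 0 := by positivity
  exact (hn.add (hn.pow 3)).sqrt hne

theorem sub_half_smul (ξ : EuclideanSpace ℝ (Fin 2)) :
    ξ - (1 / 2 : ℝ) • ξ = (1 / 2 : ℝ) • ξ := by
  module

theorem fderiv_gcPhase_half {ξ : EuclideanSpace ℝ (Fin 2)} (hξ : ξ ≠ 0) :
    fderiv ℝ (fun η => gcPhase ξ η) ((1 / 2 : ℝ) • ξ) = 0 := by
  have hd : HasFDerivAt gcDisp (fderiv ℝ gcDisp ((1 / 2 : ℝ) • ξ)) ((1 / 2 : ℝ) • ξ) :=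
    (differentiableAt_gcDisp (smul_ne_zero (by norm_num) hξ)).hasFDerivAt
  have hd' : HasFDerivAt gcDisp (fderiv ℝ gcDisp ((1 / 2 : ℝ) • ξ)) (ξ - (1 / 2 : ℝ) • ξ) := by
    rwa [sub_half_smul]
  have hr := hd'.comp ((1 / 2 : ℝ) • ξ) ((hasFDerivAt_id ((1 / 2 : ℝ) • ξ)).const_sub ξ)
  have h : HasFDerivAt (fun η => gcPhase ξ η) _ ((1 / 2 : ℝ) • ξ) :=
    (hd.const_sub (gcDisp ξ)).sub hr
  rw [h.fderiv]
  ext v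
  simp

theorem gcPhase_half_eq_zero_iff {ξ : EuclideanSpace ℝ (Fin 2)} (hξ : ξ ≠ 0) :
    gcPhase ξ ((1 / 2 : ℝ) • ξ) = 0 ↔ ‖ξ‖ = Real.sqrt 2 := by
  have hr : 0 < ‖ξ‖ := norm_pos_iff.mpr hξ
  have hhalf : ‖(1 / 2 : ℝ) • ξ‖ = ‖ξ‖ / 2 := by
    rw [norm_smul, Real.norm_of_nonneg (by norm_num)]
    ring
  have hdouble : 2 * gcDisp ((1 / 2 : ℝ) • ξ) = Real.sqrt (2 * ‖ξ‖ + ‖ξ‖ ^ 3 / 2) := by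
    rw [eq_comm, Real.sqrt_eq_iff_mul_self_eq (by positivity)
      (by unfold gcDisp; positivity), gcDisp, hhalf, mul_mul_mul_comm,
      Real.mul_self_sqrt (by positivity)]
    ring
  rw [gcPhase, sub_half_smul, sub_sub, ← two_mul, hdouble, sub_eq_zero, gcDisp,
    Real.sqrt_inj (by positivity) (by positivity), eq_comm (b := Real.sqrt 2),
    Real.sqrt_eq_iff_mul_self_eq zero_le_two hr.le]
  constructor
  · intro h
    apply mul_left_cancel₀ hr.ne'
    linarith
  · intro h
    linear_combination (-‖ξ‖ / 2) * h

/-- **Space-time resonances of the gravity-capillary system on the sphere `|ξ| = √2`.**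
For every `ξ ≠ 0`, the gradient of `η ↦ Φ(ξ,η)` vanishes at `η = ξ/2`, and
`Φ(ξ, ξ/2) = 0` iff `‖ξ‖ = √2`. -/
theorem gc_space_time_resonance (ξ : EuclideanSpace ℝ (Fin 2)) (hξ : ξ ≠ 0) :
    fderiv ℝ (fun η => gcPhase ξ η) ((1 / 2 : ℝ) • ξ) = 0 ∧
    (gcPhase ξ ((1 / 2 : ℝ) • ξ) = 0 ↔ ‖ξ‖ = Real.sqrt 2) := by
  exact ⟨fderiv_gcPhase_half hξ, gcPhase_half_eq_zero_iff hξ⟩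
end

section
/- (Existence of quadratic time resonances for gravity-capillary waves.) Define Λ(ξ) := √(|ξ| + |ξ|³) for ξ ∈ ℝ². For every ξ ∈ ℝ² with |ξ| ≥ 2 there exists t ∈ (0, 1/2) such that Λ(ξ) = Λ(tξ) + Λ(ξ − tξ). In particular, for every such ξ the set of quadratic time resonances {η ∈ ℝ² : Λ(ξ) − Λ(η) − Λ(ξ−η) = 0, η ≠ 0, η ≠ ξ} is nonempty: unlike the pure gravity case, the gravity-capillary system has large sets of quadratic time resonances. -/
/-- At the midpoint, the radial dispersion relation is strictly superadditive once `2 < r ^ 2`. -/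
theorem sqrt_half_add_sqrt_half_lt {r : ℝ} (hr : 0 < r) (hr2 : 2 < r ^ 2) :
    √(1 / 2 * r + (1 / 2 * r) ^ 3) + √((1 - 1 / 2) * r + ((1 - 1 / 2) * r) ^ 3) <
      √(r + r ^ 3) := by
  have hhalf : (1 - 1 / 2 : ℝ) = 1 / 2 := by norm_num
  rw [hhalf, ← two_mul]
  apply Real.lt_sqrt_of_sq_lt
  rw [mul_pow, Real.sq_sqrt (by positivity)]
  nlinarith [mul_pos hr (sub_pos.mpr hr2)]

/-- For a small first part `s`, the radial dispersion relation is strictly subadditive. -/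
theorem sqrt_lt_sqrt_add_sqrt_sub {r s : ℝ} (hr : 0 < r) (hs : 0 < s) (hsr : s ≤ r)
    (h : s * (1 + 3 * r ^ 2) ^ 2 ≤ r) :
    √(r + r ^ 3) < √(s + s ^ 3) + √((r - s) + (r - s) ^ 3) := by
  have hrs : 0 ≤ r - s := sub_nonneg.mpr hsr
  have ha := Real.sq_sqrt (show 0 ≤ r + r ^ 3 by positivity)
  have hb := Real.sq_sqrt (show 0 ≤ s + s ^ 3 by positivity)
  have hc := Real.sq_sqrt (show 0 ≤ (r - s) + (r - s) ^ 3 by positivity)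
  have ha0 := Real.sqrt_nonneg (r + r ^ 3)
  have hb0 := Real.sqrt_nonneg (s + s ^ 3)
  have hc0 := Real.sqrt_nonneg ((r - s) + (r - s) ^ 3)
  set a := √(r + r ^ 3)
  set b := √(s + s ^ 3)
  set c := √((r - s) + (r - s) ^ 3)
  by_contra! hle
  have hdiff : a ^ 2 - c ^ 2 ≤ s * (1 + 3 * r ^ 2) := by
    rw [ha, hc]
    nlinarith [mul_nonneg (sq_nonneg s) (show 0 ≤ 3 * r - s by linarith)]
  have hprod : b * a ≤ s * (1 + 3 * r ^ 2) := by
    nlinarith [mul_nonneg (show 0 ≤ a - c - b by linarith) ha0,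
      mul_nonneg (show 0 ≤ a - c by linarith) hc0]
  have hsq : (s + s ^ 3) * (r + r ^ 3) ≤ s * r := by
    calc (s + s ^ 3) * (r + r ^ 3) = (b * a) ^ 2 := by rw [mul_pow, ha, hb]
      _ ≤ (s * (1 + 3 * r ^ 2)) ^ 2 := by gcongr
      _ = s * (s * (1 + 3 * r ^ 2) ^ 2) := by ring
      _ ≤ s * r := by gcongr
  have : 0 < s * r ^ 3 + s ^ 3 * (r + r ^ 3) := by positivity
  linarith

/-- The radial form of the resonance equation has a solution in `(0, 1/2)`. -/
theorem exists_radial_resonance {r : ℝ} (hr : 2 ≤ r) :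
    ∃ t ∈ Set.Ioo (0 : ℝ) (1 / 2),
      √(r + r ^ 3) = √(t * r + (t * r) ^ 3) + √((1 - t) * r + ((1 - t) * r) ^ 3) := by
  have hr0 : 0 < r := by linarith
  set t₀ : ℝ := ((1 + 3 * r ^ 2) ^ 2)⁻¹ with ht₀
  have ht₀_pos : 0 < t₀ := by positivity
  have ht₀_lt : t₀ < 1 / 2 := by
    rw [ht₀, one_div]
    exact inv_strictAnti₀ (by norm_num) (by nlinarith [sq_nonneg r, sq_nonneg (r ^ 2)])
  have hsmall : √(r + r ^ 3) <
      √(t₀ * r + (t₀ * r) ^ 3) + √((1 - t₀) * r + ((1 - t₀) * r) ^ 3) := by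
    have hsub : (1 - t₀) * r = r - t₀ * r := by ring
    rw [hsub]
    refine sqrt_lt_sqrt_add_sqrt_sub hr0 (by positivity) (by nlinarith) (le_of_eq ?_)
    rw [ht₀]
    field_simp
  have hcont : ContinuousOn
      (fun t : ℝ ↦ √(t * r + (t * r) ^ 3) + √((1 - t) * r + ((1 - t) * r) ^ 3))
      (Set.Icc t₀ (1 / 2)) := by fun_prop
  obtain ⟨t, ht, h⟩ := intermediate_value_Ioo' ht₀_lt.le hcont
    ⟨sqrt_half_add_sqrt_half_lt hr0 (by nlinarith), hsmall⟩
  exact ⟨t, ⟨ht₀_pos.trans ht.1, ht.2⟩, h.symm⟩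

/-- **Existence of quadratic time resonances for gravity-capillary waves.**
For every `ξ` with `‖ξ‖ ≥ 2` there is `t ∈ (0, 1/2)` with
`Λ(ξ) = Λ(tξ) + Λ(ξ - tξ)`; in particular the set of nondegenerate quadratic
time resonances `{η : Λ(ξ) - Λ(η) - Λ(ξ-η) = 0, η ≠ 0, η ≠ ξ}` is nonempty. -/
theorem gc_time_resonances_exist (ξ : EuclideanSpace ℝ (Fin 2)) (hξ : 2 ≤ ‖ξ‖) :
    (∃ t : ℝ, t ∈ Set.Ioo (0 : ℝ) (1 / 2) ∧
      gcDisp ξ = gcDisp (t • ξ) + gcDisp (ξ - t • ξ)) ∧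
    ∃ η : EuclideanSpace ℝ (Fin 2),
      gcDisp ξ - gcDisp η - gcDisp (ξ - η) = 0 ∧ η ≠ 0 ∧ η ≠ ξ := by
  have hpos : 0 < ‖ξ‖ := by linarith
  have hne : ξ ≠ 0 := norm_pos_iff.mp hpos
  obtain ⟨t, ht, h⟩ := exists_radial_resonance hξ
  have hdisp : gcDisp ξ = gcDisp (t • ξ) + gcDisp (ξ - t • ξ) := by
    have hsub : ξ - t • ξ = (1 - t) • ξ := by rw [sub_smul, one_smul]
    rw [hsub]
    simp only [gcDisp, norm_smul, Real.norm_of_nonneg ht.1.le,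
      Real.norm_of_nonneg (show 0 ≤ 1 - t by linarith [ht.2])]
    exact h
  refine ⟨⟨t, ht, hdisp⟩, t • ξ, by linarith, smul_ne_zero ht.1.ne' hne, fun heq ↦ ?_⟩
  have ht1 : t = 1 := smul_left_injective ℝ hne (by simpa using heq)
  linarith [ht.2]
end
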